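/- Let R be a commutative Noetherian ring, 𝔞 an ideal of R, 𝒮 a Serre subcategory of the category of R-modules, and 𝒞 a class of R-modules satisfying: (1) 𝒮 ⊆ 𝒞; (2) for each M ∈ 𝒞 the quotient M/𝔞M belongs to 𝒮; (3) whenever 0 → M' → M → M'' → 0 is a short exact sequence of R-modules with M and M'' in 𝒞, also M' is in 𝒞. Let X_• : ⋯ → X_2 → X_1 → X_0 → 0 be a nonnegatively graded chain complex of R-modules such that every X_i belongs to 𝒞 and such that for every i the ideal 𝔞 is contained in the radical of the annihilator of H_i(X_•). Then H_i(X_•) belongs to 𝒮 for all i. -/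

import Mathlib

universe u

/-- A Serre subcategory of the category of `R`-modules: a class of `R`-modules,
closed under isomorphism, submodules, quotient modules and extensions. -/
structure SerreClass (R : Type u) [CommRing R] : Type (u + 1) where
  mem : ∀ (M : Type u) [AddCommGroup M] [Module R M], Prop
  mem_of_linearEquiv :
    ∀ (M N : Type u) [AddCommGroup M] [Module R M] [AddCommGroup N] [Module R N],
      (M ≃ₗ[R] N) → mem M → mem N
  mem_submodule :
    ∀ (M : Type u) [AddCommGroup M] [Module R M] (N : Submodule R M), mem M → mem N
  mem_quotient :
    ∀ (M : Type u) [AddCommGroup M] [Module R M] (N : Submodule R M), mem M → mem (M ⧸ N)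
  mem_extension :
    ∀ (M : Type u) [AddCommGroup M] [Module R M] (N : Submodule R M),
      mem N → mem (M ⧸ N) → mem M

open CategoryTheory

namespace SerreClass

variable {R : Type u} [CommRing R] (𝒮 : SerreClass R)

lemma mem_of_surjective {M N : Type u} [AddCommGroup M] [Module R M] [AddCommGroup N] [Module R N]
    (f : M →ₗ[R] N) (hf : Function.Surjective f) (hM : 𝒮.mem M) : 𝒮.mem N :=
  𝒮.mem_of_linearEquiv _ _ (f.quotKerEquivOfSurjective hf) (𝒮.mem_quotient M f.ker hM)

lemma mem_sup {M : Type u} [AddCommGroup M] [Module R M] (P Q : Submodule R M)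
    (hP : 𝒮.mem P) (hQ : 𝒮.mem Q) : 𝒮.mem ↥(P ⊔ Q) := by
  refine 𝒮.mem_extension _ (P.submoduleOf (P ⊔ Q)) ?_ ?_
  · exact 𝒮.mem_of_linearEquiv _ _ (Submodule.submoduleOfEquivOfLe le_sup_left).symm hP
  · rw [sup_comm]
    exact 𝒮.mem_of_linearEquiv _ _ (LinearMap.quotientInfEquivSupQuotient Q P)
      (𝒮.mem_quotient _ _ hQ)

open scoped Pointwise in
/-- If `M / 𝔞M` lies in `𝒮`, so does every `𝔟M` with `𝔟` finitely generated and `𝔞𝔟M = 0`. -/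
lemma mem_smul_top_of_fg {M : Type u} [AddCommGroup M] [Module R M] (𝔞 𝔟 : Ideal R)
    (h𝔟 : 𝔟.FG) (hM : 𝒮.mem (M ⧸ (𝔞 • (⊤ : Submodule R M))))
    (h : 𝔟 • 𝔞 • (⊤ : Submodule R M) = ⊥) : 𝒮.mem ↥(𝔟 • (⊤ : Submodule R M)) := by
  induction 𝔟, h𝔟 using Submodule.fg_induction with
  | singleton x =>
    rw [← Ideal.span, Submodule.ideal_span_singleton_smul] at h ⊢
    have hker : 𝔞 • (⊤ : Submodule R M) ≤ (LinearMap.lsmul R M x).ker := fun m hm ↦ by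
      have : x • m ∈ x • 𝔞 • (⊤ : Submodule R M) := Submodule.smul_mem_pointwise_smul _ _ _ hm
      rw [h] at this
      simpa using this
    have hrange : ((𝔞 • (⊤ : Submodule R M)).liftQ (LinearMap.lsmul R M x) hker).range
        = x • (⊤ : Submodule R M) := by
      rw [Submodule.range_liftQ, LinearMap.range_eq_map]
      rfl
    rw [← hrange]
    exact 𝒮.mem_of_surjective _ (LinearMap.surjective_rangeRestrict _) hM
  | sup 𝔟 𝔠 _ _ hb hc =>
    rw [Submodule.sup_smul] at h ⊢
    rw [sup_eq_bot_iff] at h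
    exact 𝒮.mem_sup _ _ (hb h.1) (hc h.2)

lemma mem_quotient_smul_top_of_surjective {M N : Type u} [AddCommGroup M] [Module R M]
    [AddCommGroup N] [Module R N] (𝔞 : Ideal R) (f : M →ₗ[R] N) (hf : Function.Surjective f)
    (hM : 𝒮.mem (M ⧸ (𝔞 • (⊤ : Submodule R M)))) : 𝒮.mem (N ⧸ (𝔞 • (⊤ : Submodule R N))) := by
  have hle : 𝔞 • (⊤ : Submodule R M) ≤ (𝔞 • (⊤ : Submodule R N)).comap f := by
    rw [← Submodule.map_le_iff_le_comap, Submodule.map_smul'']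
    exact Submodule.smul_mono le_rfl le_top
  refine 𝒮.mem_of_surjective (Submodule.mapQ _ _ f hle) ?_ hM
  intro y
  obtain ⟨y, rfl⟩ := Submodule.mkQ_surjective _ y
  obtain ⟨x, rfl⟩ := hf y
  exact ⟨Submodule.mkQ _ x, rfl⟩

lemma mem_of_pow_smul_top_eq_bot (𝔞 : Ideal R) (h𝔞 : 𝔞.FG) (n : ℕ) {M : Type u} [AddCommGroup M]
    [Module R M] (hM : 𝒮.mem (M ⧸ (𝔞 • (⊤ : Submodule R M))))
    (h : 𝔞 ^ n • (⊤ : Submodule R M) = ⊥) : 𝒮.mem M := by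
  induction n generalizing M with
  | zero =>
    have : Subsingleton M := by
      rw [← Submodule.subsingleton_iff R, ← subsingleton_iff_bot_eq_top, ← h]
      simp
    exact 𝒮.mem_of_surjective (0 : _ →ₗ[R] M) (fun x ↦ ⟨0, Subsingleton.elim _ _⟩) hM
  | succ n ih =>
    refine 𝒮.mem_extension M (𝔞 ^ n • ⊤) (𝒮.mem_smul_top_of_fg 𝔞 _ (h𝔞.pow) hM ?_) (ih ?_ ?_)
    · rwa [← Submodule.mul_smul, ← pow_succ]
    · exact 𝒮.mem_quotient_smul_top_of_surjective 𝔞 _ (Submodule.mkQ_surjective _) hM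
    · rw [← Submodule.range_mkQ (𝔞 ^ n • (⊤ : Submodule R M)), LinearMap.range_eq_map,
        ← Submodule.map_smul'', Submodule.mkQ_map_self]

lemma mem_of_le_radical_annihilator (𝔞 : Ideal R) (h𝔞 : 𝔞.FG) {M : Type u} [AddCommGroup M]
    [Module R M] (hM : 𝒮.mem (M ⧸ (𝔞 • (⊤ : Submodule R M))))
    (h : 𝔞 ≤ (Module.annihilator R M).radical) : 𝒮.mem M := by
  obtain ⟨n, hn⟩ := Ideal.exists_pow_le_of_le_radical_of_fg h h𝔞
  refine 𝒮.mem_of_pow_smul_top_eq_bot 𝔞 h𝔞 n hM ?_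
  rw [← le_bot_iff, Submodule.smul_le]
  intro r hr m _
  exact (Module.mem_annihilator.1 (hn hr) m :)

end SerreClass

open ShortComplex in
lemma ChainComplex.function_exact_iCycles {R : Type u} [CommRing R]
    (X : ChainComplex (ModuleCat.{u} R) ℕ) (i : ℕ) :
    Function.Exact (X.iCycles (i + 1)).hom (X.toCycles (i + 1) i).hom := by
  have he := (ShortExact.moduleCat_exact_iff_function_exact _).1
    (exact_of_f_is_kernel (.mk _ _ (X.iCycles_d (i + 1) i))
      (X.cyclesIsKernel (i + 1) i (ChainComplex.next_nat_succ i)))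
  have hinj := (ModuleCat.mono_iff_injective (X.iCycles i)).1 inferInstance
  intro x
  rw [← he x]
  change _ ↔ (X.d (i + 1) i) x = 0
  rw [← X.toCycles_i, ModuleCat.comp_apply, map_eq_zero_iff _ hinj]

open ShortComplex in
lemma ChainComplex.function_exact_toCycles {R : Type u} [CommRing R]
    (X : ChainComplex (ModuleCat.{u} R) ℕ) (i : ℕ) :
    Function.Exact (X.toCycles (i + 1) i).hom (X.homologyπ i).hom :=
  (ShortExact.moduleCat_exact_iff_function_exact _).1
    (exact_of_g_is_cokernel (.mk _ _ (X.toCycles_comp_homologyπ (i + 1) i))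
      (X.homologyIsCokernel (i + 1) i (ChainComplex.prev ℕ i)))

/-- Lemma 2.6: for a chain complex `⋯ → X_2 → X_1 → X_0 → 0` with all entries in `𝒞` and
`𝔞 ⊆ √(Ann H_i)` for all `i`, all homology modules lie in `𝒮`. -/
theorem homology_mem_serre_of_chainComplex
    (R : Type u) [CommRing R] [IsNoetherianRing R] (𝔞 : Ideal R) (𝒮 : SerreClass R)
    (𝒞 : ∀ (M : Type u) [AddCommGroup M] [Module R M], Prop)
    (h1 : ∀ (M : Type u) [AddCommGroup M] [Module R M], 𝒮.mem M → 𝒞 M)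
    (h2 : ∀ (M : Type u) [AddCommGroup M] [Module R M],
      𝒞 M → 𝒮.mem (M ⧸ (𝔞 • (⊤ : Submodule R M))))
    (h3 : ∀ (A B C : Type u) [AddCommGroup A] [Module R A] [AddCommGroup B] [Module R B]
      [AddCommGroup C] [Module R C] (f : A →ₗ[R] B) (g : B →ₗ[R] C),
      Function.Injective f → Function.Surjective g → Function.Exact f g → 𝒞 B → 𝒞 C → 𝒞 A)
    (X : ChainComplex (ModuleCat.{u} R) ℕ)
    (hX : ∀ i : ℕ, 𝒞 (X.X i))
    (hann : ∀ i : ℕ, 𝔞 ≤ (Module.annihilator R (X.homology i)).radical) :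
    ∀ i : ℕ, 𝒮.mem (X.homology i) := by
  have hπ (i : ℕ) : Function.Surjective (X.homologyπ i).hom :=
    (ModuleCat.epi_iff_surjective _).1 inferInstance
  have hι (i : ℕ) : Function.Injective (X.iCycles i).hom :=
    (ModuleCat.mono_iff_injective _).1 inferInstance
  have hH (i : ℕ) (hZ : 𝒞 (X.cycles i)) : 𝒮.mem (X.homology i) :=
    𝒮.mem_of_le_radical_annihilator 𝔞 (IsNoetherian.noetherian 𝔞)
      (𝒮.mem_quotient_smul_top_of_surjective 𝔞 _ (hπ i) (h2 _ hZ)) (hann i)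
  refine fun i ↦ hH i ?_
  induction i with
  | zero =>
    have h0 : 𝒞 PUnit.{u + 1} := h1 _ <|
      𝒮.mem_of_surjective 0 (fun _ ↦ ⟨0, Subsingleton.elim _ _⟩) (h2 _ (hX 0))
    refine h3 _ _ _ (X.iCycles 0).hom (0 : X.X 0 →ₗ[R] PUnit.{u + 1}) (hι 0)
      (fun _ ↦ ⟨0, Subsingleton.elim _ _⟩) (fun x ↦ ?_) (hX 0) h0
    exact iff_of_true rfl ((ModuleCat.epi_iff_surjective (X.iCycles 0)).1 inferInstance x)
  | succ i ih =>
    have hB : 𝒞 (X.homologyπ i).hom.ker :=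
      h3 _ _ _ _ _ (Submodule.injective_subtype _) (hπ i)
        (LinearMap.exact_subtype_ker_map _) ih (h1 _ (hH i ih))
    have hmem (x : X.X (i + 1)) : (X.toCycles (i + 1) i).hom x ∈ (X.homologyπ i).hom.ker :=
      (X.function_exact_toCycles i).apply_apply_eq_zero x
    refine h3 _ _ _ (X.iCycles (i + 1)).hom ((X.toCycles (i + 1) i).hom.codRestrict _ hmem)
      (hι _) ?_ (fun x ↦ ?_) (hX _) hB
    · rintro ⟨y, hy⟩
      obtain ⟨x, hx⟩ := (X.function_exact_toCycles i y).1 hy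
      exact ⟨x, Subtype.ext hx⟩
    · rw [← X.function_exact_iCycles i x, Subtype.ext_iff]
      rfl
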